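/- There exist absolute constants C, c > 0 such that for any d, t ≥ C, if n ≥ C t² d, then with probability at least p_d := 1 − C e^{t²/2}/(t d) − C e^{−c d} over the draw of x_1, …, x_n, one has inf_{w ∈ D_{t,d}} ⟨∇L(w), w − w*⟩ / ‖w − w*‖² ≥ c, where D_{t,d} := {w ∈ R^d : C t³ e^{−t²/2} ≤ ‖w − w*‖² ≤ c} is a local annulus around w*. -/

import Mathlib

open MeasureTheory ProbabilityTheory Real

noncomputable section

/-- Euclidean inner product on `Fin d → ℝ`. -/
def dot {d : ℕ} (u v : Fin d → ℝ) : ℝ := ∑ j, u j * v j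

/-- Euclidean norm on `Fin d → ℝ`. -/
def nrm {d : ℕ} (u : Fin d → ℝ) : ℝ := Real.sqrt (∑ j, (u j) ^ 2)

/-- Standard Gaussian `N(0, I_d)` on `Fin d → ℝ`. -/
def stdGaussian (d : ℕ) : Measure (Fin d → ℝ) := Measure.pi fun _ => gaussianReal 0 1

/-- Law of `n` i.i.d. draws from `N(0, I_d)`. -/
def sample (n d : ℕ) : Measure (Fin n → Fin d → ℝ) := Measure.pi fun _ => stdGaussian d

/-- `⟨∇L(w), w - w*⟩` where `∇L(w) = (1/n) Σ ((w^⊤x_i)² - (w*^⊤x_i)²)(w^⊤x_i) x_i`. -/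
def gradDot {n d : ℕ} (wstar w : Fin d → ℝ) (x : Fin n → Fin d → ℝ) : ℝ :=
  (1 / n) * ∑ i,
    ((dot w (x i)) ^ 2 - (dot wstar (x i)) ^ 2) * (dot w (x i)) * (dot (w - wstar) (x i))



/-! ### One-dimensional Gaussian facts -/

lemma gpow_integrable (k : ℕ) : Integrable (fun z : ℝ => z ^ k) (gaussianReal 0 1) := by
  have h := memLp_id_gaussianReal (μ := 0) (v := 1) (k : NNReal)
  have := h.integrable_norm_pow'
  have h2 : Integrable (fun z : ℝ => ‖z ^ k‖) (gaussianReal 0 1) := by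
    simpa using this
  exact (integrable_norm_iff (by fun_prop)).1 h2

lemma gint_iff (f : ℝ → ℝ) : Integrable f (gaussianReal 0 1) ↔
    Integrable (fun z => gaussianPDFReal 0 1 z * f z) := by
  rw [gaussianReal_of_var_ne_zero _ (by norm_num), integrable_withDensity_iff_integrable_smul' 
    (measurable_gaussianPDF 0 1) (by filter_upwards with x using gaussianPDF_lt_top)]
  simp [toReal_gaussianPDF, smul_eq_mul]

lemma gint_eq (f : ℝ → ℝ) : ∫ z, f z ∂(gaussianReal 0 1) = ∫ z, gaussianPDFReal 0 1 z * f z := by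
  rw [integral_gaussianReal_eq_integral_smul (by norm_num)]
  simp

lemma pdf_deriv (z : ℝ) : HasDerivAt (gaussianPDFReal 0 1) (-z * gaussianPDFReal 0 1 z) z := by
  have h1 : HasDerivAt (fun z : ℝ => -(z - 0) ^ 2 / (2 * ((1 : NNReal) : ℝ))) (-z) z := by
    have := (((hasDerivAt_id z).sub_const 0).pow 2).neg.div_const (2 * ((1 : NNReal) : ℝ))
    refine this.congr_deriv ?_
    simp
    ring
  have := (h1.exp).const_mul (√(2 * π * ((1 : NNReal) : ℝ)))⁻¹
  rw [gaussianPDFReal_def]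
  refine this.congr_deriv ?_
  ring

lemma powpdf_deriv (k : ℕ) (z : ℝ) : HasDerivAt (fun z => gaussianPDFReal 0 1 z * z ^ (k + 1))
    ((k + 1 : ℝ) * (gaussianPDFReal 0 1 z * z ^ k) - gaussianPDFReal 0 1 z * z ^ (k + 2)) z := by
  have := (pdf_deriv z).mul (hasDerivAt_pow (k + 1) z)
  refine this.congr_deriv ?_
  rw [Nat.add_sub_cancel]
  push_cast
  ring

lemma powpdf_integrable (k : ℕ) : Integrable (fun z => gaussianPDFReal 0 1 z * z ^ k) :=
  (gint_iff _).1 (gpow_integrable k)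

lemma gmoment_succ (k : ℕ) : ∫ z, z ^ (k + 2) ∂(gaussianReal 0 1) =
    (k + 1) * ∫ z, z ^ k ∂(gaussianReal 0 1) := by
  have h := integral_eq_zero_of_hasDerivAt_of_integrable (powpdf_deriv k)
    (((powpdf_integrable k).const_mul _).sub (powpdf_integrable (k + 2))) (powpdf_integrable (k + 1))
  rw [integral_sub ((powpdf_integrable k).const_mul _) (powpdf_integrable (k + 2)),
    integral_const_mul] at h
  rw [gint_eq, gint_eq]
  linarith

lemma gmoment2 : ∫ z, z ^ 2 ∂(gaussianReal 0 1) = 1 := by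
  rw [gmoment_succ 0]; simp

lemma gmoment4 : ∫ z, z ^ 4 ∂(gaussianReal 0 1) = 3 := by
  rw [gmoment_succ 2, gmoment2]; norm_num

lemma gmoment8 : ∫ z, z ^ 8 ∂(gaussianReal 0 1) = 105 := by
  rw [gmoment_succ 6, gmoment_succ 4, gmoment4]; norm_num

lemma gtail_Ioi (m : ℕ) (t : ℝ) (ht : 0 < t) (htm : 2 * ((m : ℝ) + 1) ≤ t ^ 2) :
    ∫ z in Set.Ioi t, gaussianPDFReal 0 1 z * z ^ (m + 2) ≤ 2 * (t ^ (m + 1) * exp (-t ^ 2 / 2)) := by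
  have hint := ((powpdf_integrable m).const_mul ((m : ℝ) + 1)).sub (powpdf_integrable (m + 2))
  have h0 := tendsto_zero_of_hasDerivAt_of_integrableOn_Ioi (a := t)
    (fun z _ => powpdf_deriv m z) hint.integrableOn (powpdf_integrable (m + 1)).integrableOn
  have h1 := integral_Ioi_of_hasDerivAt_of_tendsto' (a := t) (fun z _ => powpdf_deriv m z)
    hint.integrableOn h0
  have h2 : gaussianPDFReal 0 1 t ≤ exp (-t ^ 2 / 2) := by
    rw [gaussianPDFReal_def]
    simp only [sub_zero, NNReal.coe_one, mul_one]
    have : (√(2 * π))⁻¹ ≤ 1 := by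
      apply inv_le_one_of_one_le₀
      rw [Real.one_le_sqrt]
      nlinarith [Real.pi_gt_three]
    nlinarith [exp_pos (-t ^ 2 / 2)]
  have h3 : ∫ z in Set.Ioi t, gaussianPDFReal 0 1 z * z ^ (m + 2) ≤
      ∫ z in Set.Ioi t, -2 * ((m + 1 : ℝ) * (gaussianPDFReal 0 1 z * z ^ m)
        - gaussianPDFReal 0 1 z * z ^ (m + 2)) := by
    apply setIntegral_mono_on (powpdf_integrable (m + 2)).integrableOn
      (hint.const_mul (-2)).integrableOn measurableSet_Ioi
    intro z hz
    have hz' : t < z := hz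
    have hp := gaussianPDFReal_nonneg 0 1 z
    have hzm : 0 ≤ z ^ m := pow_nonneg (ht.trans hz').le m
    have : 2 * ((m : ℝ) + 1) ≤ z ^ 2 := by nlinarith
    have h5 := mul_le_mul_of_nonneg_right this (mul_nonneg hp hzm)
    have e : z ^ (m + 2) = z ^ 2 * z ^ m := by ring
    simp only [Pi.sub_apply]
    rw [e]
    nlinarith
  rw [integral_const_mul, h1] at h3
  have : 0 ≤ t ^ (m + 1) := by positivity
  nlinarith [mul_le_mul_of_nonneg_right h2 this]

lemma gtail (m : ℕ) (hm : Even m) (t : ℝ) (ht : 0 < t) (htm : 2 * ((m : ℝ) + 1) ≤ t ^ 2) :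
    ∫ z, (if |z| ≤ t then 0 else z ^ (m + 2)) ∂(gaussianReal 0 1)
      ≤ 4 * (t ^ (m + 1) * exp (-t ^ 2 / 2)) := by
  rw [gint_eq]
  have hev : ∀ z : ℝ, (fun z => gaussianPDFReal 0 1 z * (if |z| ≤ t then 0 else z ^ (m + 2))) z =
      (fun y => gaussianPDFReal 0 1 y * (if y ≤ t then 0 else y ^ (m + 2))) |z| := by
    intro z
    have h1 : gaussianPDFReal 0 1 |z| = gaussianPDFReal 0 1 z := by
      simp [gaussianPDFReal_def]
    have h2 : |z| ^ (m + 2) = z ^ (m + 2) := by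
      apply Even.pow_abs
      exact hm.add (by decide)
    simp only [h1, h2]
  rw [integral_congr_ae (Filter.Eventually.of_forall hev),
    integral_comp_abs (f := fun y => gaussianPDFReal 0 1 y * (if y ≤ t then 0 else y ^ (m + 2)))]
  have : ∫ y in Set.Ioi (0:ℝ), gaussianPDFReal 0 1 y * (if y ≤ t then 0 else y ^ (m + 2)) =
      ∫ z in Set.Ioi t, gaussianPDFReal 0 1 z * z ^ (m + 2) := by
    rw [← integral_indicator measurableSet_Ioi, ← integral_indicator measurableSet_Ioi]
    congr 1
    ext y
    by_cases h : y ≤ t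
    · simp [Set.indicator, h]
    · have : t < y := not_le.1 h
      simp [Set.indicator, this, ht.trans this, h]
  rw [this]
  linarith [gtail_Ioi m t ht htm]

lemma gexp_integrable : Integrable (fun z : ℝ => exp (z ^ 2 / 4)) (gaussianReal 0 1) := by
  rw [gint_iff]
  have h := (integrable_exp_neg_mul_sq (b := 1/4) (by norm_num)).const_mul (√(2 * π))⁻¹
  refine h.congr (Filter.Eventually.of_forall fun z => ?_)
  simp only [gaussianPDFReal_def, sub_zero, NNReal.coe_one, mul_one]
  rw [mul_assoc, ← exp_add]
  congr 2
  ring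

lemma gpowexp_integrable : Integrable (fun z : ℝ => z ^ 8 * exp (z ^ 2 / 8)) (gaussianReal 0 1) := by
  have h := gexp_integrable.const_mul (24 * 8 ^ 4)
  refine h.mono' (by fun_prop) (Filter.Eventually.of_forall fun z => ?_)
  rw [norm_of_nonneg (by positivity)]
  have h1 : (z ^ 2 / 8) ^ 4 / (Nat.factorial 4 : ℝ) ≤ exp (z ^ 2 / 8) :=
    pow_div_factorial_le_exp _ (by positivity) 4
  have h2 : exp (z ^ 2 / 4) = exp (z ^ 2 / 8) * exp (z ^ 2 / 8) := by
    rw [← exp_add]; congr 1; ring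
  rw [h2, ← mul_assoc]
  apply mul_le_mul_of_nonneg_right _ (exp_pos _).le
  have : (Nat.factorial 4 : ℝ) = 24 := by norm_num [Nat.factorial]
  rw [this, div_le_iff₀ (by norm_num)] at h1
  nlinarith


/-! ### Marginals of the standard Gaussian -/

instance stdG_prob (d : ℕ) : IsProbabilityMeasure (_root_.stdGaussian d) := by
  unfold _root_.stdGaussian; infer_instance

instance sample_prob (n d : ℕ) : IsProbabilityMeasure (sample n d) := by
  unfold sample; infer_instance

lemma dot_meas {d : ℕ} (u : Fin d → ℝ) : Measurable (fun x : Fin d → ℝ => dot u x) := by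
  unfold dot; fun_prop

lemma nrm_sq {d : ℕ} (u : Fin d → ℝ) : nrm u ^ 2 = ∑ j, u j ^ 2 := by
  unfold nrm; rw [Real.sq_sqrt (Finset.sum_nonneg fun _ _ => sq_nonneg _)]

lemma nrm_nonneg {d : ℕ} (u : Fin d → ℝ) : 0 ≤ nrm u := Real.sqrt_nonneg _

lemma nrm_eq {d : ℕ} (u : Fin d → ℝ) : nrm u = ‖WithLp.toLp 2 u‖ := by
  rw [EuclideanSpace.norm_eq]; simp [nrm]

lemma nrm_add_le {d : ℕ} (u v : Fin d → ℝ) : nrm (u + v) ≤ nrm u + nrm v := by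
  simp only [nrm_eq, WithLp.toLp_add]; exact norm_add_le _ _

lemma nrm_smul {d : ℕ} (r : ℝ) (u : Fin d → ℝ) : nrm (r • u) = |r| * nrm u := by
  simp only [nrm_eq, WithLp.toLp_smul, norm_smul, Real.norm_eq_abs]

lemma nrm_neg {d : ℕ} (u : Fin d → ℝ) : nrm (-u) = nrm u := by simp [nrm]

lemma nrm_cont {d : ℕ} : Continuous (fun u : Fin d → ℝ => nrm u) := by
  unfold nrm; fun_prop

lemma dot_add_left {d : ℕ} (u v x : Fin d → ℝ) : dot (u + v) x = dot u x + dot v x := by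
  simp [dot, add_mul, Finset.sum_add_distrib]

lemma dot_smul_left {d : ℕ} (r : ℝ) (u x : Fin d → ℝ) : dot (r • u) x = r * dot u x := by
  simp [dot, Finset.mul_sum, mul_assoc]

lemma dot_neg_left {d : ℕ} (u x : Fin d → ℝ) : dot (-u) x = - dot u x := by
  simp [dot]

lemma dot_sub_left {d : ℕ} (u v x : Fin d → ℝ) : dot (u - v) x = dot u x - dot v x := by
  simp [dot, sub_mul, Finset.sum_sub_distrib]

lemma dot_law {d : ℕ} (u : Fin d → ℝ) :
    (_root_.stdGaussian d).map (fun x => dot u x) =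
      (gaussianReal 0 1).map (fun z => nrm u * z) := by
  have := Measure.isFiniteMeasure_map (_root_.stdGaussian d) (fun x => dot u x)
  have := Measure.isFiniteMeasure_map (gaussianReal 0 1) (fun z => nrm u * z)
  apply Measure.ext_of_charFun
  ext s
  rw [gaussianReal_map_const_mul, charFun_gaussianReal, charFun_apply_real,
    integral_map (dot_meas u).aemeasurable (by fun_prop)]
  have h1 : ∀ x : Fin d → ℝ, Complex.exp (s * (dot u x : ℝ) * Complex.I) =
      ∏ j, (fun (j : Fin d) (y : ℝ) => Complex.exp ((s * u j : ℝ) * y * Complex.I)) j (x j) := by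
    intro x
    simp only []
    rw [← Complex.exp_sum]
    congr 1
    simp only [dot]
    push_cast
    rw [Finset.mul_sum, Finset.sum_mul]
    refine Finset.sum_congr rfl fun j _ => ?_
    ring
  simp_rw [h1]
  unfold _root_.stdGaussian
  rw [integral_fintype_prod_eq_prod
    (f := fun (j : Fin d) (y : ℝ) => Complex.exp ((s * u j : ℝ) * y * Complex.I))]
  have h2 : ∀ j : Fin d, ∫ y : ℝ, Complex.exp ((s * u j : ℝ) * y * Complex.I) ∂(gaussianReal 0 1) =
      Complex.exp (-((s * u j : ℝ) : ℂ) ^ 2 / 2) := by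
    intro j
    rw [← charFun_apply_real, charFun_gaussianReal]
    simp [neg_div]
  simp_rw [h2]
  rw [← Complex.exp_sum]
  congr 1
  have h3 : ((nrm u ^ 2 : ℝ) : ℂ) = ∑ j, (u j : ℂ) ^ 2 := by rw [nrm_sq]; push_cast; rfl
  simp only [NNReal.coe_mk, mul_one, mul_zero, Complex.ofReal_zero,
    zero_mul, zero_sub]
  rw [h3, Finset.sum_mul, Finset.sum_div, ← Finset.sum_neg_distrib]
  refine Finset.sum_congr rfl fun j _ => ?_
  push_cast
  ring

lemma dot_integral {d : ℕ} (u : Fin d → ℝ) {f : ℝ → ℝ} (hf : Measurable f) :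
    ∫ x, f (dot u x) ∂(_root_.stdGaussian d) = ∫ z, f (nrm u * z) ∂(gaussianReal 0 1) := by
  rw [← integral_map (φ := fun x => dot u x) (dot_meas u).aemeasurable hf.aestronglyMeasurable,
    dot_law, integral_map (by fun_prop) hf.aestronglyMeasurable]

lemma dot_integrable {d : ℕ} (u : Fin d → ℝ) {f : ℝ → ℝ} (hf : Measurable f) :
    Integrable (fun x => f (dot u x)) (_root_.stdGaussian d) ↔
    Integrable (fun z => f (nrm u * z)) (gaussianReal 0 1) := by
  have h1 := integrable_map_measure (μ := _root_.stdGaussian d) (f := fun x => dot u x) (g := f)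
    hf.aestronglyMeasurable (dot_meas u).aemeasurable
  have h2 := integrable_map_measure (μ := gaussianReal 0 1) (f := fun z => nrm u * z) (g := f)
    hf.aestronglyMeasurable (by fun_prop)
  rw [dot_law] at h1
  exact h1.symm.trans h2

lemma dot_pow_integrable {d : ℕ} (u : Fin d → ℝ) (k : ℕ) :
    Integrable (fun x => dot u x ^ k) (_root_.stdGaussian d) := by
  rw [dot_integrable u (f := fun y => y ^ k) (by fun_prop)]
  simp_rw [mul_pow]
  exact (gpow_integrable k).const_mul _

lemma dot_pow4 {d : ℕ} (u : Fin d → ℝ) :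
    ∫ x, dot u x ^ 4 ∂(_root_.stdGaussian d) = 3 * nrm u ^ 4 := by
  rw [dot_integral u (f := fun y => y ^ 4) (by fun_prop)]
  simp_rw [mul_pow]
  rw [integral_const_mul, gmoment4]; ring

lemma dot_pow8 {d : ℕ} (u : Fin d → ℝ) :
    ∫ x, dot u x ^ 8 ∂(_root_.stdGaussian d) = 105 * nrm u ^ 8 := by
  rw [dot_integral u (f := fun y => y ^ 8) (by fun_prop)]
  simp_rw [mul_pow]
  rw [integral_const_mul, gmoment8]; ring

lemma dot_sq_sq {d : ℕ} (w v : Fin d → ℝ) :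
    Integrable (fun x => dot w x ^ 2 * dot v x ^ 2) (_root_.stdGaussian d) ∧
    nrm w ^ 2 * nrm v ^ 2 ≤ ∫ x, dot w x ^ 2 * dot v x ^ 2 ∂(_root_.stdGaussian d) := by
  have e : ∀ x, dot w x ^ 2 * dot v x ^ 2 = (1 / 12) * (dot (w + v) x ^ 4 + dot (w - v) x ^ 4
      - 2 * dot w x ^ 4 - 2 * dot v x ^ 4) := by
    intro x; rw [dot_add_left, dot_sub_left]; ring
  have i1 := dot_pow_integrable (w + v) 4
  have i2 := dot_pow_integrable (w - v) 4
  have i3 := (dot_pow_integrable w 4).const_mul 2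
  have i4 := (dot_pow_integrable v 4).const_mul 2
  simp_rw [e]
  refine ⟨(((i1.add i2).sub i3).sub i4).const_mul _, ?_⟩
  rw [integral_const_mul, integral_sub (by exact (i1.add i2).sub i3) i4,
    integral_sub (by exact i1.add i2) i3, integral_add i1 i2, integral_const_mul,
    integral_const_mul, dot_pow4, dot_pow4, dot_pow4, dot_pow4]
  have h1 : nrm (w + v) ^ 2 = nrm w ^ 2 + nrm v ^ 2 + 2 * dot w v := by
    simp only [nrm_sq, dot, Pi.add_apply, Finset.mul_sum, ← Finset.sum_add_distrib]
    exact Finset.sum_congr rfl fun j _ => by ring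
  have h2 : nrm (w - v) ^ 2 = nrm w ^ 2 + nrm v ^ 2 - 2 * dot w v := by
    simp only [nrm_sq, dot, Pi.sub_apply, Finset.mul_sum, ← Finset.sum_add_distrib,
      ← Finset.sum_sub_distrib]
    exact Finset.sum_congr rfl fun j _ => by ring
  have h3 : nrm (w + v) ^ 4 = (nrm w ^ 2 + nrm v ^ 2 + 2 * dot w v) ^ 2 := by rw [← h1]; ring
  have h4 : nrm (w - v) ^ 4 = (nrm w ^ 2 + nrm v ^ 2 - 2 * dot w v) ^ 2 := by rw [← h2]; ring
  rw [h3, h4]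
  nlinarith [sq_nonneg (dot w v)]

/-! ### Single-sample bounds -/

/-- The truncated negative-part function. -/
def XX (t s a g : ℝ) : ℝ := if |a| ≤ t then a ^ 2 * (max (|g| - s * |a|) 0) ^ 2 else 0

lemma XX_meas (t s : ℝ) : Measurable (fun p : ℝ × ℝ => XX t s p.1 p.2) := by
  unfold XX
  refine Measurable.ite (measurableSet_le (by fun_prop) (by fun_prop)) (by fun_prop) (by fun_prop)

lemma XX_nonneg (t s a g : ℝ) : 0 ≤ XX t s a g := by
  unfold XX; split_ifs <;> positivity

lemma max_sq_le {s a g : ℝ} (hs : 0 ≤ s) : (max (|g| - s * |a|) 0) ^ 2 ≤ g ^ 2 := by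
  have h1 : 0 ≤ max (|g| - s * |a|) 0 := le_max_right _ _
  have h2 : max (|g| - s * |a|) 0 ≤ |g| := max_le (by nlinarith [abs_nonneg a]) (abs_nonneg g)
  calc _ ≤ |g| ^ 2 := by gcongr
    _ = g ^ 2 := sq_abs g

lemma XX_le {t s a g : ℝ} (hs : 0 ≤ s) : XX t s a g ≤ a ^ 2 * g ^ 2 := by
  unfold XX; split_ifs
  · exact mul_le_mul_of_nonneg_left (max_sq_le hs) (sq_nonneg a)
  · positivity

lemma XX_le' {t s a g : ℝ} (hs : 0 ≤ s) : XX t s a g ≤ t ^ 2 * g ^ 2 := by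
  unfold XX; split_ifs with h
  · have : a ^ 2 ≤ t ^ 2 := by rw [← sq_abs a]; gcongr
    have := max_sq_le (a := a) (g := g) hs
    gcongr
  · positivity

lemma XX_le4 {t s a g : ℝ} (hs : 0 < s) : XX t s a g ≤ g ^ 4 / s ^ 2 := by
  unfold XX; split_ifs with h
  · rw [le_div_iff₀ (by positivity)]
    rcases le_or_gt (|g| - s * |a|) 0 with h0 | h0
    · rw [max_eq_right h0]; simp; positivity
    · rw [max_eq_left h0.le]
      have h1 : (s * |a|) ^ 2 ≤ |g| ^ 2 := by gcongr; linarith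
      have h2 : (|g| - s * |a|) ^ 2 ≤ |g| ^ 2 := by
        gcongr; nlinarith [abs_nonneg a]
      have := mul_le_mul h1 h2 (sq_nonneg _) (sq_nonneg _)
      rw [mul_pow, sq_abs, sq_abs] at this
      nlinarith
  · positivity

lemma XX_x_meas {d : ℕ} (t s : ℝ) (w v : Fin d → ℝ) :
    Measurable (fun x => XX t s (dot w x) (dot v x)) :=
  (XX_meas t s).comp ((dot_meas w).prodMk (dot_meas v))

lemma XX_integrable {d : ℕ} (t s : ℝ) (hs : 0 ≤ s) (w v : Fin d → ℝ) :
    Integrable (fun x => XX t s (dot w x) (dot v x)) (_root_.stdGaussian d) := by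
  refine (dot_sq_sq w v).1.mono' (XX_x_meas t s w v).aestronglyMeasurable
    (Filter.Eventually.of_forall fun x => ?_)
  rw [norm_of_nonneg (XX_nonneg _ _ _ _)]
  exact XX_le hs

lemma XX_mean4 {d : ℕ} (t s : ℝ) (hs : 0 < s) (w v : Fin d → ℝ) (hv : nrm v ≤ 2) :
    ∫ x, XX t s (dot w x) (dot v x) ∂(_root_.stdGaussian d) ≤ 48 / s ^ 2 := by
  calc _ ≤ ∫ x, dot v x ^ 4 / s ^ 2 ∂(_root_.stdGaussian d) := by
        refine integral_mono (XX_integrable t s hs.le w v) ((dot_pow_integrable v 4).div_const _) ?_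
        intro x; exact XX_le4 hs
    _ = 3 * nrm v ^ 4 / s ^ 2 := by rw [integral_div, dot_pow4]
    _ ≤ _ := by
      have : nrm v ^ 4 ≤ 2 ^ 4 := by have := nrm_nonneg v; gcongr
      gcongr; linarith

lemma XX_mean0 {d : ℕ} (t : ℝ) (w v : Fin d → ℝ) (hw : nrm w = 1) (hv : nrm v ≤ 2) :
    ∫ x, XX t 0 (dot w x) (dot v x) ∂(_root_.stdGaussian d) ≤ 26 := by
  have i1 := dot_pow_integrable w 4
  have i2 := dot_pow_integrable v 4
  calc _ ≤ ∫ x, (dot w x ^ 4 + dot v x ^ 4) / 2 ∂(_root_.stdGaussian d) := by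
        refine integral_mono (XX_integrable t 0 le_rfl w v) ((i1.add i2).div_const 2) ?_
        intro x
        refine (XX_le le_rfl).trans ?_
        nlinarith [sq_nonneg (dot w x ^ 2 - dot v x ^ 2)]
    _ = (3 * nrm w ^ 4 + 3 * nrm v ^ 4) / 2 := by
      rw [integral_div, integral_add i1 i2, dot_pow4, dot_pow4]
    _ ≤ _ := by
      have : nrm v ^ 4 ≤ 2 ^ 4 := by have := nrm_nonneg v; gcongr
      rw [hw]; linarith

lemma exp_le_quad {z : ℝ} (hz : 0 ≤ z) : exp z ≤ 1 + z + z ^ 2 * exp z := by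
  have h := Real.add_one_le_exp (-z)
  have h2 : exp z * exp (-z) = 1 := by rw [← exp_add]; simp
  have hp := exp_pos z
  rcases le_or_gt 1 z with h1 | h1
  · have : 1 ≤ z ^ 2 := by nlinarith
    nlinarith
  · -- exp z * (1 - z) ≤ 1, so exp z (1 - z^2) ≤ 1 + z
    have : exp z * (1 - z) ≤ 1 := by nlinarith
    nlinarith

/-- The constant in the second order term of the moment generating function bound. -/
def BB : ℝ := 105 + 256 * ∫ z, z ^ 8 * exp (z ^ 2 / 8) ∂(gaussianReal 0 1)

lemma BB_pos : 0 < BB := by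
  unfold BB
  have : 0 ≤ ∫ z : ℝ, z ^ 8 * exp (z ^ 2 / 8) ∂(gaussianReal 0 1) :=
    integral_nonneg fun z => by positivity
  linarith

lemma upper_mgf {d : ℕ} (t s m : ℝ) (ht : 0 < t) (hs : 0 ≤ s) (w v : Fin d → ℝ) (hw : nrm w = 1)
    (hv : nrm v ≤ 2) (hm : ∫ x, XX t s (dot w x) (dot v x) ∂(_root_.stdGaussian d) ≤ m) :
    Integrable (fun x => exp (XX t s (dot w x) (dot v x) / (64 * t ^ 2))) (_root_.stdGaussian d) ∧
    ∫ x, exp (XX t s (dot w x) (dot v x) / (64 * t ^ 2)) ∂(_root_.stdGaussian d) ≤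
      exp ((m / 64 + BB / t ^ 2) / t ^ 2) := by
  have hv0 := nrm_nonneg v
  have hv2 : nrm v ^ 2 ≤ 4 := by nlinarith
  have hv8 : nrm v ^ 8 ≤ 256 := by
    calc _ ≤ (2 : ℝ) ^ 8 := by gcongr
      _ = 256 := by norm_num
  have ig : Integrable (fun x => dot v x ^ 8 * exp (dot v x ^ 2 / 32)) (_root_.stdGaussian d) ∧
      ∫ x, dot v x ^ 8 * exp (dot v x ^ 2 / 32) ∂(_root_.stdGaussian d) ≤
        256 * ∫ z, z ^ 8 * exp (z ^ 2 / 8) ∂(gaussianReal 0 1) := by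
    have hb : ∀ z : ℝ, (nrm v * z) ^ 8 * exp ((nrm v * z) ^ 2 / 32) ≤
        256 * (z ^ 8 * exp (z ^ 2 / 8)) := by
      intro z
      rw [← mul_assoc, mul_pow, mul_pow]
      have : nrm v ^ 2 * z ^ 2 / 32 ≤ z ^ 2 / 8 := by nlinarith [sq_nonneg z]
      have h8 : 0 ≤ z ^ 8 := by positivity
      gcongr
    have hi : Integrable (fun z => (nrm v * z) ^ 8 * exp ((nrm v * z) ^ 2 / 32))
        (gaussianReal 0 1) := by
      refine (gpowexp_integrable.const_mul 256).mono' (by fun_prop)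
        (Filter.Eventually.of_forall fun z => ?_)
      rw [norm_of_nonneg (by positivity)]
      exact hb z
    constructor
    · rw [dot_integrable v (f := fun y => y ^ 8 * exp (y ^ 2 / 32)) (by fun_prop)]
      exact hi
    · rw [dot_integral v (f := fun y => y ^ 8 * exp (y ^ 2 / 32)) (by fun_prop),
        ← integral_const_mul]
      exact integral_mono hi (gpowexp_integrable.const_mul 256) hb
  have hpt : ∀ x, exp (XX t s (dot w x) (dot v x) / (64 * t ^ 2)) ≤
      1 + XX t s (dot w x) (dot v x) / (64 * t ^ 2) +
        (dot w x ^ 8 + dot v x ^ 8 * exp (dot v x ^ 2 / 32)) / t ^ 4 := by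
    intro x
    generalize dot w x = a
    generalize dot v x = g
    have h0 := XX_nonneg t s a g
    set z := XX t s a g / (64 * t ^ 2) with hz
    have hz0 : 0 ≤ z := by positivity
    have h1 : z ≤ g ^ 2 / 64 := by
      rw [hz, div_le_div_iff₀ (by positivity) (by norm_num)]
      nlinarith [XX_le' (t := t) (a := a) (g := g) hs]
    have h2 : z ^ 2 ≤ a ^ 4 * g ^ 4 / t ^ 4 := by
      have : z ≤ a ^ 2 * g ^ 2 / t ^ 2 := by
        rw [hz]
        have := XX_le (t := t) (a := a) (g := g) hs
        have h64 : t ^ 2 ≤ 64 * t ^ 2 := by nlinarith [sq_nonneg t]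
        gcongr
      calc z ^ 2 ≤ (a ^ 2 * g ^ 2 / t ^ 2) ^ 2 := by gcongr
        _ = _ := by rw [div_pow]; ring
    refine (exp_le_quad hz0).trans ?_
    gcongr
    have h3 : exp z ≤ exp (g ^ 2 / 64) := exp_le_exp.2 h1
    calc z ^ 2 * exp z ≤ a ^ 4 * g ^ 4 / t ^ 4 * exp (g ^ 2 / 64) := by
          gcongr
      _ = (a ^ 4 * (g ^ 4 * exp (g ^ 2 / 64))) / t ^ 4 := by ring
      _ ≤ _ := by
        have e : exp (g ^ 2 / 32) = exp (g ^ 2 / 64) ^ 2 := by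
          rw [← exp_nat_mul]; congr 1; push_cast; ring
        rw [e]
        gcongr
        nlinarith [sq_nonneg (a ^ 4 - g ^ 4 * exp (g ^ 2 / 64)), sq_nonneg (a ^ 4),
          sq_nonneg (g ^ 4 * exp (g ^ 2 / 64))]
  have i1 := (XX_integrable t s hs w v).div_const (64 * t ^ 2)
  have i0 : Integrable (fun _ : Fin d → ℝ => (1 : ℝ)) (_root_.stdGaussian d) := integrable_const 1
  have i2 := ((dot_pow_integrable w 8).add ig.1).div_const (t ^ 4)
  have iR := (i0.add i1).add i2
  have iL : Integrable (fun x => exp (XX t s (dot w x) (dot v x) / (64 * t ^ 2)))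
      (_root_.stdGaussian d) := by
    refine iR.mono' ?_ (Filter.Eventually.of_forall fun x => ?_)
    · exact (Real.measurable_exp.comp ((XX_x_meas t s w v).div_const _)).aestronglyMeasurable
    · rw [norm_of_nonneg (exp_pos _).le]
      exact hpt x
  refine ⟨iL, (integral_mono iL iR hpt).trans ?_⟩
  have : ∫ x, ((1 : ℝ) + XX t s (dot w x) (dot v x) / (64 * t ^ 2) +
        (dot w x ^ 8 + dot v x ^ 8 * exp (dot v x ^ 2 / 32)) / t ^ 4) ∂(_root_.stdGaussian d)
      ≤ 1 + m / (64 * t ^ 2) + BB / t ^ 4 := by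
    rw [integral_add (by exact i0.add i1) (by exact i2), integral_add i0 i1, integral_div,
      integral_div, integral_add (dot_pow_integrable w 8) ig.1, dot_pow8, hw]
    simp only [integral_const, probReal_univ, smul_eq_mul, mul_one, one_pow]
    unfold BB
    gcongr
    exact ig.2
  refine this.trans ?_
  have e : (m / 64 + BB / t ^ 2) / t ^ 2 = m / (64 * t ^ 2) + BB / t ^ 4 := by
    field_simp
  rw [e]
  have := Real.add_one_le_exp (m / (64 * t ^ 2) + BB / t ^ 4)
  linarith

lemma lower_mgf {d : ℕ} (t : ℝ) (ht : 32 ≤ t) (w v : Fin d → ℝ) (hw : nrm w = 1)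
    (hv : nrm v ≤ 2) (hv1 : 1 / 2 ≤ nrm v) :
    Integrable (fun x => exp (-(1 / 112000) * XX t 0 (dot w x) (dot v x)))
      (_root_.stdGaussian d) ∧
    ∫ x, exp (-(1 / 112000) * XX t 0 (dot w x) (dot v x)) ∂(_root_.stdGaussian d) ≤
      exp (-(1 / 1792000)) := by
  have hv0 := nrm_nonneg v
  have hv4 : nrm v ^ 4 ≤ 16 := by
    calc _ ≤ (2 : ℝ) ^ 4 := by gcongr
      _ = 16 := by norm_num
  have hv8 : nrm v ^ 8 ≤ 256 := by
    calc _ ≤ (2 : ℝ) ^ 8 := by gcongr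
      _ = 256 := by norm_num
  have hv2 : 1 / 4 ≤ nrm v ^ 2 := by nlinarith
  set l : ℝ := 1 / 112000 with hl
  have ix := XX_integrable t 0 le_rfl w v
  have iw8 := dot_pow_integrable w 8
  have iv8 := dot_pow_integrable v 8
  have iv4 := dot_pow_integrable v 4
  have hq := dot_sq_sq w v
  have hpt : ∀ x, exp (-l * XX t 0 (dot w x) (dot v x)) ≤
      1 - l * XX t 0 (dot w x) (dot v x) + l ^ 2 / 4 * (dot w x ^ 8 + dot v x ^ 8) := by
    intro x
    generalize dot w x = a
    generalize dot v x = g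
    have h0 := XX_nonneg t 0 a g
    have h1 := XX_le (t := t) (a := a) (g := g) (le_refl (0 : ℝ))
    have h2 : XX t 0 a g ^ 2 ≤ (a ^ 8 + g ^ 8) / 2 := by
      calc _ ≤ (a ^ 2 * g ^ 2) ^ 2 := by gcongr
        _ ≤ _ := by nlinarith [sq_nonneg (a ^ 4 - g ^ 4)]
    have h3 : ∀ y : ℝ, 0 ≤ y → exp (-y) ≤ 1 - y + y ^ 2 / 2 := by
      intro y hy
      have h := Real.quadratic_le_exp_of_nonneg hy
      rw [exp_neg, inv_le_comm₀ (exp_pos _) (by nlinarith [sq_nonneg (y - 1)])]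
      refine le_trans ?_ h
      rw [inv_le_iff_one_le_mul₀ (by nlinarith [sq_nonneg (y - 1)])]
      nlinarith [sq_nonneg (y ^ 2)]
    have h4 := h3 (l * XX t 0 a g) (by positivity)
    rw [neg_mul]
    refine h4.trans ?_
    nlinarith [mul_le_mul_of_nonneg_left h2 (sq_nonneg l)]
  have i0 : Integrable (fun _ : Fin d → ℝ => (1 : ℝ)) (_root_.stdGaussian d) := integrable_const 1
  have i1 := ix.const_mul l
  have i2 := (iw8.add iv8).const_mul (l ^ 2 / 4)
  have iR := (i0.sub i1).add i2
  have iL : Integrable (fun x => exp (-l * XX t 0 (dot w x) (dot v x)))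
      (_root_.stdGaussian d) := by
    refine iR.mono' ?_ (Filter.Eventually.of_forall fun x => ?_)
    · exact (Real.measurable_exp.comp ((XX_x_meas t 0 w v).const_mul _)).aestronglyMeasurable
    · rw [norm_of_nonneg (exp_pos _).le]
      exact hpt x
  refine ⟨iL, (integral_mono iL iR hpt).trans ?_⟩
  -- lower bound on the mean
  have hmean : 1 / 8 ≤ ∫ x, XX t 0 (dot w x) (dot v x) ∂(_root_.stdGaussian d) := by
    have hp : ∀ x, dot w x ^ 2 * dot v x ^ 2 - 1 / (2 * t ^ 2) * (dot w x ^ 8 + dot v x ^ 4) ≤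
        XX t 0 (dot w x) (dot v x) := by
      intro x
      generalize dot w x = a
      generalize dot v x = g
      unfold XX
      split_ifs with h
      · have : max (|g| - 0 * |a|) 0 = |g| := by simp
        rw [this, sq_abs]
        have : 0 ≤ 1 / (2 * t ^ 2) * (a ^ 8 + g ^ 4) := by positivity
        linarith
      · push Not at h
        have h1 : t ^ 2 ≤ a ^ 2 := by rw [← sq_abs a]; gcongr
        have h2 : a ^ 2 * g ^ 2 ≤ 1 / (2 * t ^ 2) * (a ^ 8 + g ^ 4) := by
          rw [div_mul_eq_mul_div, one_mul, le_div_iff₀ (by positivity)]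
          have := mul_le_mul_of_nonneg_left h1 (by positivity : 0 ≤ a ^ 2 * g ^ 2)
          nlinarith [sq_nonneg (a ^ 4 - g ^ 2)]
        linarith
    have i3 := (iw8.add iv4).const_mul (1 / (2 * t ^ 2))
    have := integral_mono (hq.1.sub i3) ix hp
    have e := integral_sub hq.1 i3
    simp only [Pi.sub_apply, Pi.add_apply] at this e
    rw [e, integral_const_mul, integral_add iw8 iv4, dot_pow8, dot_pow4, hw] at this
    have h5 := hq.2
    rw [hw] at h5
    have h6 : 1 / (2 * t ^ 2) * (105 * 1 ^ 8 + 3 * nrm v ^ 4) ≤ 1 / 8 := by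
      rw [div_mul_eq_mul_div, one_mul, div_le_iff₀ (by positivity)]
      nlinarith
    linarith
  have : ∫ x, ((1 : ℝ) - l * XX t 0 (dot w x) (dot v x) + l ^ 2 / 4 * (dot w x ^ 8 + dot v x ^ 8))
      ∂(_root_.stdGaussian d) ≤ 1 - 1 / 1792000 := by
    rw [integral_add (by exact i0.sub i1) (by exact i2), integral_sub i0 i1, integral_const_mul,
      integral_const_mul, integral_add iw8 iv8, dot_pow8, dot_pow8, hw]
    simp only [integral_const, probReal_univ, smul_eq_mul, mul_one, one_pow]
    rw [hl]
    nlinarith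
  refine this.trans ?_
  have := Real.add_one_le_exp (-(1 / 1792000) : ℝ)
  linarith


/-! ### Sample-level machinery -/

/-- Euclidean balls as subsets of `Fin d → ℝ`. -/
def Bl (d : ℕ) (r : ℝ) : Set (Fin d → ℝ) := {v | nrm v ≤ r}

lemma Bl_meas (d : ℕ) (r : ℝ) : MeasurableSet (Bl d r) :=
  (isClosed_le nrm_cont continuous_const).measurableSet

open Pointwise in
lemma Bl_vol (d : ℕ) {r : ℝ} (hr : 0 < r) :
    volume (Bl d r) = ENNReal.ofReal (r ^ d) * volume (Bl d 1) := by
  have h : Bl d r = r • Bl d 1 := by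
    ext v
    rw [Set.mem_smul_set_iff_inv_smul_mem₀ hr.ne']
    simp only [Bl, Set.mem_ofPred_eq, nrm_smul]
    rw [abs_of_pos (inv_pos.2 hr), inv_mul_le_iff₀ hr, mul_one]
  rw [h, Measure.addHaar_smul]
  simp [abs_of_pos hr]

lemma Bl_pos (d : ℕ) : volume (Bl d 1) ≠ 0 := by
  have ho : IsOpen {v : Fin d → ℝ | nrm v < 1} := isOpen_lt nrm_cont continuous_const
  have hne : {v : Fin d → ℝ | nrm v < 1}.Nonempty := ⟨0, by simp [nrm]⟩
  have := ho.measure_pos volume hne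
  refine (lt_of_lt_of_le this (measure_mono ?_)).ne'
  intro v hv
  exact (show nrm v < 1 from hv).le

lemma Bl_fin (d : ℕ) : volume (Bl d 1) ≠ ⊤ := by
  have hs : Bl d 1 ⊆ Metric.closedBall 0 1 := by
    intro v hv
    rw [mem_closedBall_zero_iff, pi_norm_le_iff_of_nonneg zero_le_one]
    intro j
    have h1 : nrm v ^ 2 ≤ 1 := by
      have := nrm_nonneg v
      have hv : nrm v ≤ 1 := hv
      nlinarith
    rw [nrm_sq] at h1
    have h2 : v j ^ 2 ≤ ∑ j, v j ^ 2 :=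
      Finset.single_le_sum (f := fun j => v j ^ 2) (fun _ _ => sq_nonneg _) (Finset.mem_univ j)
    rw [Real.norm_eq_abs, ← sq_le_one_iff_abs_le_one]
    linarith
  exact ((measure_mono hs).trans_lt measure_closedBall_lt_top).ne

lemma markov_avg {n d : ℕ} (φ : (Fin d → ℝ) → (Fin d → ℝ) → ℝ)
    (hφ : Measurable (Function.uncurry φ)) (S : Set (Fin d → ℝ)) (hS : MeasurableSet S) (β : ℝ)
    (h : ∀ v ∈ S, Integrable (fun x => exp (φ v x)) (_root_.stdGaussian d) ∧
      ∫ x, exp (φ v x) ∂(_root_.stdGaussian d) ≤ exp β) (K : ENNReal) :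
    K * sample n d {x | K ≤ ∫⁻ v in S, ENNReal.ofReal (exp (∑ i, φ v (x i)))} ≤
      ENNReal.ofReal (exp (n * β)) * volume S := by
  have hm : Measurable (fun p : (Fin n → Fin d → ℝ) × (Fin d → ℝ) =>
      ENNReal.ofReal (exp (∑ i, φ p.2 (p.1 i)))) := by
    refine ENNReal.measurable_ofReal.comp (Real.measurable_exp.comp ?_)
    refine Finset.measurable_sum _ fun i _ => ?_
    exact hφ.comp (measurable_snd.prodMk ((measurable_pi_apply i).comp measurable_fst))
  refine (mul_meas_ge_le_lintegral (hm.lintegral_prod_right' (ν := volume.restrict S)) K).trans ?_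
  rw [lintegral_lintegral_swap (by exact hm.aemeasurable)]
  have : ∀ v ∈ S, ∫⁻ x, ENNReal.ofReal (exp (∑ i, φ v (x i))) ∂(sample n d) ≤
      ENNReal.ofReal (exp (n * β)) := by
    intro v hv
    have e : ∀ x : Fin n → Fin d → ℝ, exp (∑ i, φ v (x i)) = ∏ i, exp (φ v (x i)) :=
      fun x => Real.exp_sum _ _
    simp_rw [e]
    have hi : Integrable (fun x : Fin n → Fin d → ℝ => ∏ i, exp (φ v (x i))) (sample n d) :=
      Integrable.fintype_prod (f := fun _ y => exp (φ v y)) (fun _ => (h v hv).1)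
    rw [← ofReal_integral_eq_lintegral_ofReal hi (Filter.Eventually.of_forall fun x => by positivity)]
    apply ENNReal.ofReal_le_ofReal
    unfold sample
    rw [integral_fintype_prod_eq_pow (f := fun y => exp (φ v y)), Fintype.card_fin, exp_nat_mul]
    have : 0 ≤ ∫ y, exp (φ v y) ∂(_root_.stdGaussian d) := integral_nonneg fun _ => (exp_pos _).le
    gcongr
    exact (h v hv).2
  calc _ ≤ ∫⁻ v in S, ENNReal.ofReal (exp (n * β)) := setLIntegral_mono' hS this
    _ = _ := by rw [setLIntegral_const]

lemma cancelV {V P : ENNReal} (hV : V ≠ 0) (hV' : V ≠ ⊤) {k q E : ℝ} (hk : 0 < k) (hE : 0 ≤ E)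
    (h : (ENNReal.ofReal k * V) * P ≤ ENNReal.ofReal E * (ENNReal.ofReal q * V)) :
    P ≤ ENNReal.ofReal (E * q / k) := by
  have h1 : V * (ENNReal.ofReal k * P) ≤ V * (ENNReal.ofReal E * ENNReal.ofReal q) := by
    calc _ = (ENNReal.ofReal k * V) * P := by ring
      _ ≤ _ := h
      _ = _ := by ring
  rw [ENNReal.mul_le_mul_iff_right hV hV'] at h1
  rw [ENNReal.ofReal_div_of_pos hk, ENNReal.ofReal_mul hE,
    ENNReal.le_div_iff_mul_le (Or.inl (by simpa using hk)) (Or.inl ENNReal.ofReal_ne_top), mul_comm]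
  exact h1

lemma XX_mid (t s a g k : ℝ) : 2 * XX t s a g ≤ XX t s a (g + k) + XX t s a (g - k) := by
  unfold XX
  split_ifs
  · set c := s * |a|
    have h1 : |2 * g| ≤ |g + k| + |g - k| := by
      have := abs_add_le (g + k) (g - k)
      rwa [show g + k + (g - k) = 2 * g by ring] at this
    rw [abs_mul, abs_two] at h1
    have a1 := le_max_left (|g + k| - c) 0
    have a2 := le_max_right (|g + k| - c) 0
    have b1 := le_max_left (|g - k| - c) 0
    have b2 := le_max_right (|g - k| - c) 0
    have h2 : max (|g| - c) 0 ≤ (max (|g + k| - c) 0 + max (|g - k| - c) 0) / 2 :=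
      max_le (by linarith) (by linarith)
    have h3 : 0 ≤ max (|g| - c) 0 := le_max_right _ _
    set M := max (|g| - c) 0
    set A := max (|g + k| - c) 0
    set B := max (|g - k| - c) 0
    have h4 : 2 * M ^ 2 ≤ A ^ 2 + B ^ 2 := by
      have : M ^ 2 ≤ ((A + B) / 2) ^ 2 := by gcongr
      nlinarith [sq_nonneg (A - B)]
    nlinarith [mul_le_mul_of_nonneg_left h4 (sq_nonneg a)]
  · simp

lemma XX_unc_meas {d : ℕ} (t s : ℝ) (w : Fin d → ℝ) :
    Measurable (Function.uncurry fun v x : Fin d → ℝ => XX t s (dot w x) (dot v x)) := by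
  refine (XX_meas t s).comp (Measurable.prodMk ((dot_meas w).comp measurable_snd) ?_)
  show Measurable (fun p : (Fin d → ℝ) × (Fin d → ℝ) => ∑ j, p.1 j * p.2 j)
  fun_prop

lemma convex_avg {d : ℕ} (G : (Fin d → ℝ) → ℝ) (hG : Measurable G)
    (hc : ∀ u z, 2 * G u ≤ G (u + z) + G (u - z)) (u : Fin d → ℝ) (hu : nrm u ≤ 1) :
    ENNReal.ofReal (exp (G u)) * volume (Bl d 1) ≤
      ∫⁻ v in Bl d 2, ENNReal.ofReal (exp (G v)) := by
  set f : (Fin d → ℝ) → ENNReal := fun v => ENNReal.ofReal (exp (G v)) with hf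
  have fm : Measurable f := ENNReal.measurable_ofReal.comp (Real.measurable_exp.comp hG)
  have fi : Measurable ((Bl d 2).indicator f) := fm.indicator (Bl_meas d 2)
  have hpt : ∀ z ∈ Bl d 1, 2 * f u ≤
      (Bl d 2).indicator f (u + z) + (Bl d 2).indicator f (u - z) := by
    intro z hz
    have hz : nrm z ≤ 1 := hz
    have m1 : u + z ∈ Bl d 2 := (nrm_add_le u z).trans (by linarith)
    have m2 : u - z ∈ Bl d 2 := by
      rw [sub_eq_add_neg]
      exact (nrm_add_le u (-z)).trans (by rw [nrm_neg]; linarith)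
    rw [Set.indicator_of_mem m1, Set.indicator_of_mem m2]
    simp only [hf]
    rw [← ENNReal.ofReal_add (exp_pos _).le (exp_pos _).le,
      show (2 : ENNReal) = ENNReal.ofReal 2 by simp, ← ENNReal.ofReal_mul (by norm_num)]
    apply ENNReal.ofReal_le_ofReal
    have h1 : exp (G u) ≤ exp (G (u + z) / 2) * exp (G (u - z) / 2) := by
      rw [← exp_add]; exact exp_le_exp.2 (by linarith [hc u z])
    have h2 : exp (G (u + z)) = exp (G (u + z) / 2) ^ 2 := by
      rw [← exp_nat_mul]; congr 1; push_cast; ring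
    have h3 : exp (G (u - z)) = exp (G (u - z) / 2) ^ 2 := by
      rw [← exp_nat_mul]; congr 1; push_cast; ring
    rw [h2, h3]
    nlinarith [sq_nonneg (exp (G (u + z) / 2) - exp (G (u - z) / 2))]
  have h2 : 2 * (f u * volume (Bl d 1)) ≤ 2 * ∫⁻ v in Bl d 2, f v := by
    calc 2 * (f u * volume (Bl d 1)) = ∫⁻ z in Bl d 1, 2 * f u := by
          rw [setLIntegral_const, mul_assoc]
      _ ≤ ∫⁻ z in Bl d 1, ((Bl d 2).indicator f (u + z) + (Bl d 2).indicator f (u - z)) :=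
          setLIntegral_mono' (Bl_meas d 1) hpt
      _ ≤ ∫⁻ z, ((Bl d 2).indicator f (u + z) + (Bl d 2).indicator f (u - z)) :=
          setLIntegral_le_lintegral _ _
      _ = (∫⁻ z, (Bl d 2).indicator f (u + z)) + ∫⁻ z, (Bl d 2).indicator f (u - z) :=
          lintegral_add_left (fi.comp (measurable_const_add u)) _
      _ = 2 * ∫⁻ v in Bl d 2, f v := by
          rw [lintegral_add_left_eq_self, lintegral_sub_left_eq_self,
            lintegral_indicator (Bl_meas d 2), two_mul]
  rwa [ENNReal.mul_le_mul_iff_right (by norm_num) (by norm_num)] at h2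

lemma upper_event {n d : ℕ} (t s m η : ℝ) (ht : 0 < t) (hs : 0 ≤ s) (w : Fin d → ℝ)
    (hw : nrm w = 1)
    (hm : ∀ v : Fin d → ℝ, nrm v ≤ 2 →
      ∫ x, XX t s (dot w x) (dot v x) ∂(_root_.stdGaussian d) ≤ m)
    (hη : BB / t ^ 2 ≤ η) (hn : 2 * t ^ 2 * d ≤ η * n) :
    sample n d {x | ∃ u : Fin d → ℝ, nrm u ≤ 1 ∧
      n * (m + 128 * η) < ∑ i, XX t s (dot w (x i)) (dot u (x i))} ≤
      ENNReal.ofReal (exp (-d)) := by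
  set φ : (Fin d → ℝ) → (Fin d → ℝ) → ℝ := fun v x => XX t s (dot w x) (dot v x) / (64 * t ^ 2)
    with hφ
  have hφm : Measurable (Function.uncurry φ) := (XX_unc_meas t s w).div_const _
  set β := (m / 64 + η) / t ^ 2 with hβ
  set k := exp (n * ((m / 64 + 2 * η) / t ^ 2)) with hk
  have hmk := markov_avg (n := n) φ hφm (Bl d 2) (Bl_meas d 2) β (by
    intro v hv
    have := upper_mgf t s m ht hs w v hw hv (hm v hv)
    refine ⟨this.1, this.2.trans ?_⟩
    apply exp_le_exp.2
    rw [hβ]; gcongr) (ENNReal.ofReal k * volume (Bl d 1))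
  rw [Bl_vol d (by norm_num : (0:ℝ) < 2)] at hmk
  have h1 := cancelV (Bl_pos d) (Bl_fin d) (exp_pos _) (exp_pos _).le hmk
  refine (measure_mono ?_).trans (h1.trans (ENNReal.ofReal_le_ofReal ?_))
  · rintro x ⟨u, hu, hux⟩
    have hc := convex_avg (fun v => ∑ i, φ v (x i)) (by
        refine Finset.measurable_sum _ fun i _ => ?_
        exact hφm.of_uncurry_right) (by
        intro u z
        simp only [hφ, Finset.mul_sum, ← Finset.sum_add_distrib]
        refine Finset.sum_le_sum fun i _ => ?_
        rw [dot_add_left, dot_sub_left, ← add_div, ← mul_div_assoc]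
        gcongr
        exact XX_mid _ _ _ _ _) u hu
    refine le_trans ?_ hc
    gcongr
    simp only [hφ]
    rw [← Finset.sum_div, hk]
    apply exp_le_exp.2
    rw [le_div_iff₀ (by positivity)]
    have e : n * ((m / 64 + 2 * η) / t ^ 2) * (64 * t ^ 2) = n * (m + 128 * η) := by
      field_simp; ring
    rw [e]; exact hux.le
  · rw [div_le_iff₀ (exp_pos _), ← exp_add]
    have h2 : (2 : ℝ) ^ d ≤ exp d := by
      have := Real.add_one_le_exp (1 : ℝ)
      rw [← mul_one (d : ℝ), exp_nat_mul]
      gcongr; linarith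
    calc exp (n * β) * 2 ^ d ≤ exp (n * β) * exp d := by gcongr
      _ = exp (n * β + d) := by rw [exp_add]
      _ ≤ _ := by
        apply exp_le_exp.2
        have : 2 * d ≤ n * (η / t ^ 2) := by
          rw [← mul_div_assoc, le_div_iff₀ (by positivity)]; linarith
        have e : n * ((m / 64 + 2 * η) / t ^ 2) = n * β + n * (η / t ^ 2) := by
          rw [hβ]; ring
        rw [e]; linarith

lemma XX0_eq (t a g : ℝ) : XX t 0 a g = if |a| ≤ t then a ^ 2 * g ^ 2 else 0 := by
  unfold XX; simp

lemma lower_event {n d : ℕ} (t : ℝ) (ht : 32 ≤ t) (w : Fin d → ℝ) (hw : nrm w = 1)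
    (hn : 6 * 3584000 * (d : ℝ) ≤ n) :
    sample n d {x | (∀ u : Fin d → ℝ, nrm u ≤ 1 →
        ∑ i, XX t 0 (dot w (x i)) (dot u (x i)) ≤ 27 * n) ∧
      ∃ u : Fin d → ℝ, nrm u = 1 ∧ ∑ i, XX t 0 (dot w (x i)) (dot u (x i)) < n / 128} ≤
      ENNReal.ofReal (exp (-d)) := by
  set φ : (Fin d → ℝ) → (Fin d → ℝ) → ℝ :=
    fun v x => -(1 / 112000) * XX t 0 (dot w x) (dot v x) with hφ
  have hφm : Measurable (Function.uncurry φ) := (XX_unc_meas t 0 w).const_mul _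
  set S : Set (Fin d → ℝ) := {v | 1 / 2 ≤ nrm v} ∩ Bl d 2 with hS
  have hSm : MeasurableSet S :=
    (isClosed_le continuous_const nrm_cont).measurableSet.inter (Bl_meas d 2)
  set k := exp (-(n / 3584000)) * (1 / 64) ^ d with hk
  have hmk := markov_avg (n := n) φ hφm S hSm (-(1 / 1792000)) (by
    intro v hv
    exact lower_mgf t ht w v hw hv.2 hv.1) (ENNReal.ofReal k * volume (Bl d 1))
  have hmk2 := hmk.trans (mul_le_mul_right (measure_mono (Set.inter_subset_right :
    S ⊆ Bl d 2)) (ENNReal.ofReal (exp (n * (-(1 / 1792000))))))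
  rw [Bl_vol d (by norm_num : (0:ℝ) < 2)] at hmk2
  have h1 := cancelV (Bl_pos d) (Bl_fin d) (by positivity) (exp_pos _).le hmk2
  refine (measure_mono ?_).trans (h1.trans (ENNReal.ofReal_le_ofReal ?_))
  · rintro x ⟨hub, u, hu, hux⟩
    simp only [Set.mem_ofPred_eq]
    have key : ∀ z ∈ Bl d (1 / 64), ENNReal.ofReal (exp (-(n / 3584000))) ≤
        S.indicator (fun v => ENNReal.ofReal (exp (∑ i, φ v (x i)))) (u + z) := by
      intro z hz
      have hz : nrm z ≤ 1 / 64 := hz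
      have hmem : u + z ∈ S := by
        constructor
        · have h := nrm_add_le (u + z) (-z)
          rw [add_neg_cancel_right, nrm_neg, hu] at h
          show 1 / 2 ≤ nrm (u + z)
          linarith
        · exact (nrm_add_le u z).trans (by linarith)
      rw [Set.indicator_of_mem hmem]
      apply ENNReal.ofReal_le_ofReal
      apply exp_le_exp.2
      have hzz := hub ((64 : ℝ) • z) (by rw [nrm_smul, abs_of_pos (by norm_num)]; linarith)
      have hs : ∑ i, XX t 0 (dot w (x i)) (dot (u + z) (x i)) ≤
          2 * (∑ i, XX t 0 (dot w (x i)) (dot u (x i))) +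
          1 / 2048 * ∑ i, XX t 0 (dot w (x i)) (dot ((64 : ℝ) • z) (x i)) := by
        rw [Finset.mul_sum, Finset.mul_sum, ← Finset.sum_add_distrib]
        refine Finset.sum_le_sum fun i _ => ?_
        rw [dot_add_left, dot_smul_left]
        generalize dot w (x i) = a
        generalize dot u (x i) = g
        generalize dot z (x i) = h
        simp only [XX0_eq]
        split_ifs
        · nlinarith [mul_nonneg (sq_nonneg a) (sq_nonneg (g - h))]
        · simp
      simp only [hφ, ← Finset.mul_sum]
      have hn0 : (0 : ℝ) ≤ n := Nat.cast_nonneg n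
      linarith
    calc ENNReal.ofReal k * volume (Bl d 1)
        = ENNReal.ofReal (exp (-(n / 3584000))) * volume (Bl d (1 / 64)) := by
          rw [hk, Bl_vol d (by norm_num : (0:ℝ) < 1 / 64), ENNReal.ofReal_mul (exp_pos _).le,
            mul_assoc]
      _ = ∫⁻ z in Bl d (1 / 64), ENNReal.ofReal (exp (-(n / 3584000))) := by
          rw [setLIntegral_const]
      _ ≤ ∫⁻ z in Bl d (1 / 64),
            S.indicator (fun v => ENNReal.ofReal (exp (∑ i, φ v (x i)))) (u + z) :=
          setLIntegral_mono' (Bl_meas d _) key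
      _ ≤ ∫⁻ z, S.indicator (fun v => ENNReal.ofReal (exp (∑ i, φ v (x i)))) (u + z) :=
          setLIntegral_le_lintegral _ _
      _ = _ := by rw [lintegral_add_left_eq_self, lintegral_indicator hSm]
  · rw [hk, div_le_iff₀ (by positivity), ← mul_assoc, ← exp_add]
    have h2 : (2 : ℝ) ^ d ≤ exp (5 * d) * (1 / 64) ^ d := by
      have h3 : (128 : ℝ) ≤ exp 5 := by
        have h4 : (2.7 : ℝ) ≤ exp 1 := by linarith [Real.exp_one_gt_d9]
        have h5 : exp 5 = exp 1 ^ 5 := by rw [← exp_nat_mul]; norm_num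
        rw [h5]
        calc (128 : ℝ) ≤ 2.7 ^ 5 := by norm_num
          _ ≤ _ := by gcongr
      rw [mul_comm (5 : ℝ), exp_nat_mul, ← mul_pow]
      gcongr
      linarith
    calc _ ≤ exp (n * (-(1 / 1792000))) * (exp (5 * d) * (1 / 64) ^ d) := by gcongr
      _ = exp (n * (-(1 / 1792000)) + 5 * d) * (1 / 64) ^ d := by rw [exp_add, mul_assoc]
      _ ≤ _ := by
        refine mul_le_mul_of_nonneg_right (exp_le_exp.2 ?_) (by positivity)
        linarith

/-- The tail fourth power. -/
def YY (t a : ℝ) : ℝ := if |a| ≤ t then 0 else a ^ 4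

lemma YY_meas (t : ℝ) : Measurable (YY t) := by
  unfold YY
  exact Measurable.ite (measurableSet_le (by fun_prop) (by fun_prop)) (by fun_prop) (by fun_prop)

lemma YY_nonneg (t a : ℝ) : 0 ≤ YY t a := by unfold YY; split_ifs <;> positivity

lemma YY_memLp {d : ℕ} (t : ℝ) (w : Fin d → ℝ) :
    MemLp (fun x => YY t (dot w x)) 2 (_root_.stdGaussian d) := by
  refine (memLp_two_iff_integrable_sq ((YY_meas t).comp (dot_meas w)).aestronglyMeasurable).2 ?_
  refine (dot_pow_integrable w 8).mono'
    (((YY_meas t).comp (dot_meas w)).pow_const 2).aestronglyMeasurable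
    (Filter.Eventually.of_forall fun x => ?_)
  rw [norm_of_nonneg (by positivity)]
  simp only [Function.comp_apply, YY]
  split_ifs
  · simp; positivity
  · exact le_of_eq (by ring)

lemma tail_event {n d : ℕ} (t : ℝ) (ht : 4 ≤ t) (hn : 0 < n) (w : Fin d → ℝ) (hw : nrm w = 1) :
    sample n d {x | n * (5 * (t ^ 3 * exp (-t ^ 2 / 2))) ≤ ∑ i, YY t (dot w (x i))} ≤
      ENNReal.ofReal (4 * t * exp (t ^ 2 / 2) / n) := by
  set E0 := exp (-t ^ 2 / 2) with hE0
  have hE : 0 < E0 := exp_pos _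
  have ht0 : 0 < t := by linarith
  have hn' : (0 : ℝ) < n := by exact_mod_cast hn
  have hm := YY_memLp t w
  have hmean : ∫ x, YY t (dot w x) ∂(_root_.stdGaussian d) ≤ 4 * (t ^ 3 * E0) := by
    rw [dot_integral w (YY_meas t), hw]
    simp only [one_mul]
    exact gtail 2 (by decide) t ht0 (by push_cast; nlinarith)
  have hvar : Var[fun x => YY t (dot w x); _root_.stdGaussian d] ≤ 4 * (t ^ 7 * E0) := by
    refine (variance_le_expectation_sq hm.1).trans ?_
    have e : ∀ x, ((fun x => YY t (dot w x)) ^ 2) x =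
        (fun a => if |a| ≤ t then 0 else a ^ 8) (dot w x) := by
      intro x
      simp only [Pi.pow_apply, YY]
      split_ifs
      · simp
      · ring
    rw [integral_congr_ae (Filter.Eventually.of_forall e), dot_integral w
      (f := fun a => if |a| ≤ t then 0 else a ^ 8) (Measurable.ite (measurableSet_le (by fun_prop) (by fun_prop)) (by fun_prop) (by fun_prop)),
      hw]
    simp only [one_mul]
    exact gtail 6 (by decide) t ht0 (by push_cast; nlinarith)
  have hmi : ∀ i : Fin n, MemLp (fun x : Fin n → Fin d → ℝ => YY t (dot w (x i))) 2 (sample n d) :=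
    fun i => hm.comp_measurePreserving
      (measurePreserving_eval (fun _ : Fin n => _root_.stdGaussian d) i)
  have hsum : MemLp (∑ i : Fin n, fun x : Fin n → Fin d → ℝ => YY t (dot w (x i))) 2
      (sample n d) := memLp_finsetSum' _ fun i _ => hmi i
  have hv : Var[∑ i : Fin n, fun x : Fin n → Fin d → ℝ => YY t (dot w (x i)); sample n d] ≤
      n * (4 * (t ^ 7 * E0)) := by
    unfold sample
    rw [variance_sum_pi (X := fun _ x => YY t (dot w x)) (fun _ => hm)]
    simp only [Finset.sum_const, Finset.card_univ, Fintype.card_fin, nsmul_eq_mul]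
    gcongr
  have he : (sample n d)[∑ i : Fin n, fun x : Fin n → Fin d → ℝ => YY t (dot w (x i))] ≤
      n * (4 * (t ^ 3 * E0)) := by
    simp only [Finset.sum_apply]
    rw [integral_finsetSum _ fun i _ => (hmi i).integrable (by norm_num)]
    have : ∀ i : Fin n, ∫ x : Fin n → Fin d → ℝ, YY t (dot w (x i)) ∂(sample n d) =
        ∫ x, YY t (dot w x) ∂(_root_.stdGaussian d) := by
      intro i
      unfold sample
      exact integral_comp_eval (μ := fun _ : Fin n => _root_.stdGaussian d)
        (f := fun x => YY t (dot w x)) hm.1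
    simp only [this, Finset.sum_const, Finset.card_univ, Fintype.card_fin, nsmul_eq_mul]
    gcongr
  have hcpos : 0 < n * (t ^ 3 * E0) := by positivity
  have := meas_ge_le_variance_div_sq hsum hcpos
  refine (measure_mono ?_).trans (this.trans (ENNReal.ofReal_le_ofReal ?_))
  · intro x hx
    simp only [Set.mem_ofPred_eq] at hx ⊢
    refine le_trans ?_ (le_abs_self _)
    rw [Finset.sum_apply]
    linarith
  · calc _ ≤ n * (4 * (t ^ 7 * E0)) / (n * (t ^ 3 * E0)) ^ 2 := by gcongr
      _ = 4 * t * E0⁻¹ / n := by field_simp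
      _ = _ := by
        rw [hE0, ← exp_neg]; congr 3; ring


/-! ### Deterministic pointwise bound and conclusion -/

lemma pointwise_bound {t r : ℝ} (hr : 0 < r) (hr1 : r ≤ 1 / 2048) (a g : ℝ) :
    r ^ 2 * (3 / 4 * XX t 0 a g - 4 * XX t 512 a g) - YY t a ≤
      ((a + r * g) ^ 2 - a ^ 2) * (a + r * g) * (r * g) := by
  have e : ((a + r * g) ^ 2 - a ^ 2) * (a + r * g) * (r * g) =
      (r * g) ^ 2 * ((a + r * g) * (2 * a + r * g)) := by ring
  rw [e]
  set b := r * g with hb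
  have hbabs : |b| = r * |g| := by rw [hb, abs_mul, abs_of_pos hr]
  have hq : -(1 / 4) * a ^ 2 ≤ (a + b) * (2 * a + b) := by nlinarith [sq_nonneg (3 * a + 2 * b)]
  have hb2 := mul_le_mul_of_nonneg_left hq (sq_nonneg b)
  by_cases h : |a| ≤ t
  · rw [XX0_eq]
    simp only [XX, YY, h, if_true]
    rcases le_or_gt |b| (|a| / 2) with h1 | h1
    · have h2 : b ^ 2 ≤ (a / 2) ^ 2 := by
        rw [sq_le_sq, abs_div, abs_two]; exact h1
      have h3 : 3 / 4 * a ^ 2 ≤ (a + b) * (2 * a + b) := by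
        have h4 : |a * b| ≤ a ^ 2 / 2 := by
          rw [abs_mul, ← sq_abs a]; nlinarith [abs_nonneg a]
        have := neg_abs_le (a * b)
        have h5 : 0 ≤ (a / 2 + b) * (5 * a / 2 + b) := by
          rcases le_total 0 a with ha | ha
          · rw [abs_of_nonneg ha] at h1
            have := abs_le.1 h1
            exact mul_nonneg (by linarith) (by linarith)
          · rw [abs_of_nonpos ha] at h1
            have := abs_le.1 h1
            exact mul_nonneg_of_nonpos_of_nonpos (by linarith) (by linarith)
        nlinarith
      have h6 := mul_le_mul_of_nonneg_left h3 (sq_nonneg b)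
      have h7 : 0 ≤ r ^ 2 * (a ^ 2 * max (|g| - 512 * |a|) 0 ^ 2) := by positivity
      have h8 : b ^ 2 = r ^ 2 * g ^ 2 := by rw [hb]; ring
      nlinarith
    · have h2 : |g| / 2 ≤ max (|g| - 512 * |a|) 0 := by
        refine le_trans ?_ (le_max_left _ _)
        have : r * |g| ≤ 1 / 2048 * |g| := by gcongr
        linarith
      have h3 : (|g| / 2) ^ 2 ≤ (max (|g| - 512 * |a|) 0) ^ 2 := by gcongr
      rw [div_pow, sq_abs] at h3
      have h4 := mul_le_mul_of_nonneg_left h3 (by positivity : 0 ≤ r ^ 2 * a ^ 2)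
      have h8 : b ^ 2 = r ^ 2 * g ^ 2 := by rw [hb]; ring
      rw [h8] at hb2 ⊢
      nlinarith
  · simp only [XX, YY, h, if_false]
    rcases le_or_gt |b| (2 * |a|) with h1 | h1
    · have h2 : b ^ 2 ≤ (2 * a) ^ 2 := by
        rw [sq_le_sq, abs_mul 2 a, abs_two]; exact h1
      nlinarith [mul_le_mul_of_nonneg_left h2 (sq_nonneg a)]
    · have h3 : 0 ≤ (a + b) * (2 * a + b) := by
        have ha := abs_le.1 (le_refl |a|)
        have h0 := abs_nonneg a
        rcases le_total 0 b with hb' | hb'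
        · rw [abs_of_nonneg hb'] at h1
          exact mul_nonneg (by linarith) (by linarith)
        · rw [abs_of_nonpos hb'] at h1
          exact mul_nonneg_of_nonpos_of_nonpos (by linarith) (by linarith)
      have := mul_nonneg (sq_nonneg b) h3
      have h4 : 0 ≤ a ^ 4 := by positivity
      linarith

lemma det_bound {n d : ℕ} (t C : ℝ) (hC : 5120 ≤ C) (ht : 0 < t) (hn : 0 < n)
    (wstar w : Fin d → ℝ) (x : Fin n → Fin d → ℝ)
    (h0 : ∀ u : Fin d → ℝ, nrm u = 1 →
      (n : ℝ) / 128 ≤ ∑ i, XX t 0 (dot wstar (x i)) (dot u (x i)))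
    (h1 : ∀ u : Fin d → ℝ, nrm u ≤ 1 →
      ∑ i, XX t 512 (dot wstar (x i)) (dot u (x i)) ≤ n * (48 / 512 ^ 2 + 128 * (1 / 2 ^ 19)))
    (h2 : ∑ i, YY t (dot wstar (x i)) ≤ n * (5 * (t ^ 3 * exp (-t ^ 2 / 2))))
    (hw1 : C * t ^ 3 * exp (-t ^ 2 / 2) ≤ nrm (w - wstar) ^ 2)
    (hw2 : nrm (w - wstar) ^ 2 ≤ 1 / 2048 ^ 2) :
    1 / 2048 ^ 2 ≤ gradDot wstar w x / nrm (w - wstar) ^ 2 := by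
  set r := nrm (w - wstar) with hr
  have hn' : (0 : ℝ) < n := by exact_mod_cast hn
  have hr2 : 0 < r ^ 2 := lt_of_lt_of_le (by positivity) hw1
  have hrn : 0 ≤ r := nrm_nonneg _
  have hr0 : 0 < r := by
    rcases hrn.lt_or_eq with h | h
    · exact h
    · rw [← h] at hr2; simp at hr2
  have hr1 : r ≤ 1 / 2048 := by
    have : r ^ 2 ≤ (1 / 2048) ^ 2 := by rw [div_pow, one_pow]; exact hw2
    exact (pow_le_pow_iff_left₀ hrn (by norm_num) (by norm_num)).1 this
  set u := r⁻¹ • (w - wstar) with hu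
  have hu1 : nrm u = 1 := by
    rw [hu, nrm_smul, abs_of_pos (inv_pos.2 hr0), ← hr, inv_mul_cancel₀ hr0.ne']
  have hru : w - wstar = r • u := by rw [hu, smul_inv_smul₀ hr0.ne']
  have hd1 : ∀ y, dot (w - wstar) y = r * dot u y := by
    intro y; rw [hru, dot_smul_left]
  have hd2 : ∀ y, dot w y = dot wstar y + r * dot u y := by
    intro y
    rw [← hd1, dot_sub_left]; ring
  rw [le_div_iff₀ hr2]
  unfold gradDot
  rw [div_mul_eq_mul_div (1:ℝ) (n:ℝ), one_mul, le_div_iff₀ hn']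
  have hs : r ^ 2 * (3 / 4 * ∑ i, XX t 0 (dot wstar (x i)) (dot u (x i))
      - 4 * ∑ i, XX t 512 (dot wstar (x i)) (dot u (x i))) - ∑ i, YY t (dot wstar (x i)) ≤
      ∑ i, ((dot w (x i)) ^ 2 - (dot wstar (x i)) ^ 2) * (dot w (x i)) *
        (dot (w - wstar) (x i)) := by
    simp only [Finset.mul_sum, ← Finset.sum_sub_distrib]
    refine Finset.sum_le_sum fun i _ => ?_
    rw [hd1, hd2]
    have := pointwise_bound (t := t) hr0 hr1 (dot wstar (x i)) (dot u (x i))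
    linarith
  refine le_trans ?_ hs
  have a0 := h0 u hu1
  have a1 := h1 u hu1.le
  have hbr : (n : ℝ) * (4 / 1024) ≤ 3 / 4 * ∑ i, XX t 0 (dot wstar (x i)) (dot u (x i))
      - 4 * ∑ i, XX t 512 (dot wstar (x i)) (dot u (x i)) := by
    norm_num at a0 a1 ⊢
    linarith
  have hm := mul_le_mul_of_nonneg_left hbr hr2.le
  have hE : 5120 * (t ^ 3 * exp (-t ^ 2 / 2)) ≤ r ^ 2 := by
    refine le_trans ?_ hw1
    rw [mul_assoc C]
    have : 0 ≤ t ^ 3 * exp (-t ^ 2 / 2) := by positivity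
    gcongr
  have hE2 : n * (5 * (t ^ 3 * exp (-t ^ 2 / 2))) ≤ n * (r ^ 2 / 1024) := by
    gcongr
    linarith
  have : 0 < r ^ 2 * n := by positivity
  norm_num at *
  linarith


/-- **Theorem 3.2 (Positive Result)**: there exist absolute constants `C, c > 0` such that for
`d, t ≥ C` and `n ≥ C t² d`, with probability at least `1 - C e^{t²/2}/(t d) - C e^{-c d}`,
`inf_{w ∈ D_{t,d}} ⟨∇L(w), w - w*⟩ / ‖w - w*‖² ≥ c`, where
`D_{t,d} = {w : C t³ e^{-t²/2} ≤ ‖w - w*‖² ≤ c}`. -/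
theorem stmt3 :
    ∃ C > (0 : ℝ), ∃ c > (0 : ℝ),
      ∀ (n d : ℕ) (t : ℝ) (wstar : Fin d → ℝ),
        nrm wstar = 1 → C ≤ (d : ℝ) → C ≤ t → C * t ^ 2 * d ≤ (n : ℝ) →
        1 - C * Real.exp (t ^ 2 / 2) / (t * d) - C * Real.exp (-c * d) ≤
          (sample n d {x | ∀ w : Fin d → ℝ,
              C * t ^ 3 * Real.exp (-t ^ 2 / 2) ≤ (nrm (w - wstar)) ^ 2 →
              (nrm (w - wstar)) ^ 2 ≤ c →
              c ≤ gradDot wstar w x / (nrm (w - wstar)) ^ 2}).toReal := by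
  have hBB := BB_pos
  refine ⟨2 ^ 40 + BB * 2 ^ 19, by positivity, 1 / 2048 ^ 2, by norm_num, ?_⟩
  set C : ℝ := 2 ^ 40 + BB * 2 ^ 19 with hC
  intro n d t wstar hw hd ht hn
  have hC1 : (2 : ℝ) ^ 40 ≤ C := by rw [hC]; nlinarith
  have hC0 : 0 < C := by positivity
  have ht0 : 0 < t := by linarith
  have hd0 : (0 : ℝ) < d := by linarith
  have ht1 : 1 ≤ t := le_trans (by norm_num) (hC1.trans ht)
  have ht2 : t ≤ t ^ 2 := by nlinarith
  have hn0 : (0 : ℝ) < n := lt_of_lt_of_le (by positivity) hn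
  have hnN : 0 < n := by exact_mod_cast hn0
  have htd : (d : ℝ) ≤ t ^ 2 * d := by nlinarith
  have hη : BB / t ^ 2 ≤ 1 / 2 ^ 19 := by
    rw [div_le_div_iff₀ (by positivity) (by positivity)]
    have : BB * 2 ^ 19 ≤ C := by rw [hC]; linarith [pow_pos (by norm_num : (0:ℝ) < 2) 40]
    linarith
  have hn40 : 2 ^ 40 * (t ^ 2 * d) ≤ n := by
    refine le_trans ?_ hn
    rw [mul_assoc C]
    gcongr
  have hnη : 2 * t ^ 2 * d ≤ 1 / 2 ^ 19 * n := by
    norm_num at hn40 ⊢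
    nlinarith [mul_pos (pow_pos ht0 2) hd0]
  have hnl : 6 * 3584000 * (d : ℝ) ≤ n := by
    norm_num at hn40 ⊢
    linarith
  have e1 := upper_event (n := n) t 0 26 (1 / 2 ^ 19) ht0 le_rfl wstar hw
    (fun v hv => XX_mean0 t wstar v hw hv) hη hnη
  have e2 := upper_event (n := n) t 512 (48 / 512 ^ 2) (1 / 2 ^ 19) ht0 (by norm_num) wstar hw
    (fun v hv => XX_mean4 t 512 (by norm_num) wstar v hv) hη hnη
  have e3 := lower_event (n := n) t (le_trans (by norm_num) (hC1.trans ht)) wstar hw hnl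
  have e4 := tail_event (n := n) t (le_trans (by norm_num) (hC1.trans ht)) hnN wstar hw
  set G := {x : Fin n → Fin d → ℝ | ∀ w : Fin d → ℝ,
              C * t ^ 3 * Real.exp (-t ^ 2 / 2) ≤ (nrm (w - wstar)) ^ 2 →
              (nrm (w - wstar)) ^ 2 ≤ 1 / 2048 ^ 2 →
              1 / 2048 ^ 2 ≤ gradDot wstar w x / (nrm (w - wstar)) ^ 2} with hG
  set B1 := {x : Fin n → Fin d → ℝ | ∃ u : Fin d → ℝ, nrm u ≤ 1 ∧
      n * (26 + 128 * (1 / 2 ^ 19)) < ∑ i, XX t 0 (dot wstar (x i)) (dot u (x i))} with hB1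
  set B2 := {x : Fin n → Fin d → ℝ | ∃ u : Fin d → ℝ, nrm u ≤ 1 ∧
      n * (48 / 512 ^ 2 + 128 * (1 / 2 ^ 19)) <
        ∑ i, XX t 512 (dot wstar (x i)) (dot u (x i))} with hB2
  set B3 := {x : Fin n → Fin d → ℝ | (∀ u : Fin d → ℝ, nrm u ≤ 1 →
        ∑ i, XX t 0 (dot wstar (x i)) (dot u (x i)) ≤ 27 * n) ∧
      ∃ u : Fin d → ℝ, nrm u = 1 ∧
        ∑ i, XX t 0 (dot wstar (x i)) (dot u (x i)) < n / 128} with hB3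
  set B4 := {x : Fin n → Fin d → ℝ | n * (5 * (t ^ 3 * exp (-t ^ 2 / 2))) ≤
      ∑ i, YY t (dot wstar (x i))} with hB4
  have hcover : (Set.univ : Set (Fin n → Fin d → ℝ)) ⊆ G ∪ (B1 ∪ (B2 ∪ (B3 ∪ B4))) := by
    intro x _
    by_cases c1 : x ∈ B1
    · exact Or.inr (Or.inl c1)
    by_cases c2 : x ∈ B2
    · exact Or.inr (Or.inr (Or.inl c2))
    by_cases c3 : x ∈ B3
    · exact Or.inr (Or.inr (Or.inr (Or.inl c3)))
    by_cases c4 : x ∈ B4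
    · exact Or.inr (Or.inr (Or.inr (Or.inr c4)))
    refine Or.inl ?_
    intro w hw1 hw2
    have c1' : ∀ u : Fin d → ℝ, nrm u ≤ 1 →
        ∑ i, XX t 0 (dot wstar (x i)) (dot u (x i)) ≤ 27 * n := by
      intro u hu
      by_contra hcon
      push Not at hcon
      refine c1 ⟨u, hu, lt_of_le_of_lt ?_ hcon⟩
      norm_num
      linarith
    refine det_bound t C (le_trans (by norm_num) hC1) ht0 hnN wstar w x ?_ ?_ ?_ hw1 hw2
    · intro u hu
      by_contra hcon
      push Not at hcon
      exact c3 ⟨c1', u, hu, hcon⟩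
    · intro u hu
      by_contra hcon
      push Not at hcon
      exact c2 ⟨u, hu, hcon⟩
    · by_contra hcon
      push Not at hcon
      exact c4 hcon.le
  have hP : ENNReal.ofReal 1 ≤ sample n d G + ENNReal.ofReal (exp (-d) + (exp (-d) + (exp (-d) +
      4 * t * exp (t ^ 2 / 2) / n))) := by
    rw [ENNReal.ofReal_add (by positivity) (by positivity),
      ENNReal.ofReal_add (by positivity) (by positivity),
      ENNReal.ofReal_add (by positivity) (by positivity), ENNReal.ofReal_one,
      ← measure_univ (μ := sample n d)]
    refine (measure_mono hcover).trans ((measure_union_le _ _).trans ?_)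
    gcongr
    refine (measure_union_le _ _).trans (add_le_add e1 ?_)
    refine (measure_union_le _ _).trans (add_le_add e2 ?_)
    exact (measure_union_le _ _).trans (add_le_add e3 e4)
  have hPr : 1 ≤ (sample n d G).toReal + (exp (-d) + (exp (-d) + (exp (-d) +
      4 * t * exp (t ^ 2 / 2) / n))) := by
    rw [← ENNReal.ofReal_toReal (measure_ne_top (sample n d) G),
      ← ENNReal.ofReal_add ENNReal.toReal_nonneg (by positivity)] at hP
    exact (ENNReal.ofReal_le_ofReal_iff (by positivity)).1 hP
  have b1 : 3 * exp (-d) ≤ C * exp (-(1 / 2048 ^ 2) * d) := by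
    have h1 : exp (-(d : ℝ)) ≤ exp (-(1 / 2048 ^ 2) * d) := by
      apply exp_le_exp.2
      norm_num
      linarith
    have h2 : (3 : ℝ) ≤ C := le_trans (by norm_num) hC1
    gcongr
  have b2 : 4 * t * exp (t ^ 2 / 2) / n ≤ C * exp (t ^ 2 / 2) / (t * d) := by
    rw [div_le_div_iff₀ hn0 (by positivity)]
    have h3 : 4 * t * (t * d) ≤ C * n := by
      have h4 : t ^ 2 * d ≤ n := by
        have : 0 < t ^ 2 * d := by positivity
        norm_num at hn40
        linarith
      have h5 : (4 : ℝ) ≤ C := le_trans (by norm_num) hC1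
      calc 4 * t * (t * d) = 4 * (t ^ 2 * d) := by ring
        _ ≤ C * n := by gcongr
    nlinarith [exp_pos (t ^ 2 / 2)]
  linarith
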